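/- Let F : ℝ^d → ℝ be rational linear, m : ℝ^d → ℝ rational piecewise linear, convex, and positive away from 0, and q a rational positive definite quadratic form. Let σ ⊆ ℝ^d be a rational polyhedral cone with σ ∩ {F < 0} ≠ ∅. Order ℝ² lexicographically and define μ(v) := (F(v)/m(v), F(v)/√q(v)) on σ \ {0}. Then inf_{v ∈ σ \ {0}} μ(v) is achieved at a unique ray in σ, and this ray contains a rational point. -/

import Mathlib

/-- A rational polyhedral cone in `ℝ^d`: the cone generated by finitely many rational
vectors. -/
def IsRationalPolyhedralCone {d : ℕ} (σ : Set (Fin d → ℝ)) : Prop :=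
  ∃ S : Finset (Fin d → ℚ),
    σ = { v | ∃ c : (Fin d → ℚ) → ℝ, (∀ g, 0 ≤ c g) ∧
          v = ∑ g ∈ S, c g • (fun i => (g i : ℝ)) }

/-- A rational linear functional on `ℝ^d`. -/
def IsRationalLinear {d : ℕ} (F : (Fin d → ℝ) → ℝ) : Prop :=
  ∃ a : Fin d → ℚ, ∀ v, F v = ∑ i, (a i : ℝ) * v i

/-- A rational piecewise linear function on `ℝ^d`. -/
def IsRationalPiecewiseLinear {d : ℕ} (m : (Fin d → ℝ) → ℝ) : Prop :=
  ∃ (n : ℕ) (σ : Fin n → Set (Fin d → ℝ)) (L : Fin n → (Fin d → ℝ) → ℝ),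
    (∀ i, IsRationalPolyhedralCone (σ i)) ∧ (⋃ i, σ i) = Set.univ ∧
    ∀ i, IsRationalLinear (L i) ∧ ∀ v ∈ σ i, m v = L i v

theorem aux_cone_closed {d : ℕ} {ι : Type*} [DecidableEq ι] (f : ι → Fin d → ℝ) (n : ℕ) :
    ∀ T : Finset ι, T.card = n →
    IsClosed { v : Fin d → ℝ | ∃ c : ι → ℝ, (∀ i ∈ T, 0 ≤ c i) ∧ v = ∑ i ∈ T, c i • f i } := by
  induction n with
  | zero =>
    intro T hT
    rw [Finset.card_eq_zero] at hT
    subst hT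
    have : { v : Fin d → ℝ | ∃ c : ι → ℝ, (∀ i ∈ (∅ : Finset ι), 0 ≤ c i) ∧
        v = ∑ i ∈ (∅ : Finset ι), c i • f i } = {0} := by
      ext v; simp
    rw [this]; exact isClosed_singleton
  | succ n ih =>
    intro T hT
    by_cases hli : LinearIndependent ℝ (fun i : T => f i)
    · let Φ : (T → ℝ) →ₗ[ℝ] (Fin d → ℝ) := Fintype.linearCombination ℝ (fun i : T => f i)
      have hinj : Function.Injective Φ := by
        rw [Fintype.linearIndependent_iff] at hli
        rw [injective_iff_map_eq_zero]
        intro g hg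
        funext i
        exact hli g (by simpa [Φ, Fintype.linearCombination_apply] using hg) i
      have hce := LinearMap.isClosedEmbedding_of_injective (f := Φ) (LinearMap.ker_eq_bot.2 hinj)
      have hcl : IsClosed {c : T → ℝ | ∀ i, 0 ≤ c i} := by
        simp only [Set.ofPred_forall]
        exact isClosed_iInter fun i => isClosed_le continuous_const (continuous_apply i)
      have := hce.isClosedMap _ hcl
      convert this using 1
      ext v
      constructor
      · rintro ⟨c, hc, rfl⟩
        refine ⟨fun i => c i, fun i => hc i i.2, ?_⟩
        simp only [Φ, Fintype.linearCombination_apply]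
        exact Finset.sum_coe_sort T (fun i => c i • f i)
      · rintro ⟨c, hc, rfl⟩
        refine ⟨fun i => if h : i ∈ T then c ⟨i, h⟩ else 0, fun i hi => ?_, ?_⟩
        · simp only [hi, dif_pos]; exact hc _
        · simp only [Φ, Fintype.linearCombination_apply]
          rw [← Finset.sum_coe_sort T]
          refine Finset.sum_congr rfl fun i _ => ?_
          simp
    · have hU : { v : Fin d → ℝ | ∃ c : ι → ℝ, (∀ i ∈ T, 0 ≤ c i) ∧ v = ∑ i ∈ T, c i • f i } =
          ⋃ j ∈ T, { v : Fin d → ℝ | ∃ c : ι → ℝ, (∀ i ∈ T.erase j, 0 ≤ c i) ∧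
            v = ∑ i ∈ T.erase j, c i • f i } := by
        have hdep : ∃ g : ι → ℝ, ∑ i ∈ T, g i • f i = 0 ∧ ∃ i ∈ T, 0 < g i := by
          rw [Fintype.not_linearIndependent_iff] at hli
          obtain ⟨g, hg, i, hi⟩ := hli
          let g' : ι → ℝ := fun i => if h : i ∈ T then g ⟨i, h⟩ else 0
          have hg' : ∑ i ∈ T, g' i • f i = 0 := by
            rw [← Finset.sum_coe_sort T, ← hg]
            refine Finset.sum_congr rfl fun i _ => ?_
            simp [g']
          have hi' : g' i ≠ 0 := by simpa [g'] using hi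
          rcases lt_or_gt_of_ne hi' with h | h
          · refine ⟨fun i => - g' i, ?_, i, i.2, by simpa using h⟩
            simp [hg']
          · exact ⟨g', hg', i, i.2, h⟩
        obtain ⟨g, hg, i₀, hi₀, hpos⟩ := hdep
        ext v
        simp only [Set.mem_iUnion, Set.mem_ofPred_eq, exists_prop]
        constructor
        · rintro ⟨c, hc, rfl⟩
          obtain ⟨j, hj, hmin⟩ := Finset.exists_min_image (T.filter fun i => 0 < g i)
            (fun i => c i / g i) ⟨i₀, by simp [hi₀, hpos]⟩
          rw [Finset.mem_filter] at hj
          have hcj : 0 ≤ c j / g j := div_nonneg (hc j hj.1) hj.2.le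
          refine ⟨j, hj.1, fun i => c i - (c j / g j) * g i, ?_, ?_⟩
          · intro i hi
            have hiT := Finset.mem_of_mem_erase hi
            rcases lt_or_ge 0 (g i) with h | h
            · have := hmin i (by simp [hiT, h])
              rw [le_div_iff₀ h] at this
              linarith
            · have := mul_nonneg hcj (neg_nonneg.2 h)
              have := hc i hiT
              nlinarith
          · have h1 : ∑ i ∈ T, (c i - (c j / g j) * g i) • f i = ∑ i ∈ T, c i • f i := by
              simp only [sub_smul, mul_smul, Finset.sum_sub_distrib, ← Finset.smul_sum, hg]
              simp
            rw [← h1, ← Finset.add_sum_erase T _ hj.1]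
            have : c j - c j / g j * g j = 0 := by
              field_simp [hj.2.ne']; simp
            rw [this]; simp
        · rintro ⟨j, hj, c, hc, rfl⟩
          refine ⟨fun i => if i = j then 0 else c i, ?_, ?_⟩
          · intro i hi
            by_cases h : i = j
            · simp [h]
            · simp only [h, if_false]; exact hc i (Finset.mem_erase.2 ⟨h, hi⟩)
          · rw [← Finset.add_sum_erase T _ hj]
            simp only [if_true, zero_smul, zero_add]
            refine Finset.sum_congr rfl fun i hi => ?_
            simp [(Finset.mem_erase.1 hi).1]
      rw [hU]
      refine Set.Finite.isClosed_biUnion T.finite_toSet fun j hj => ?_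
      exact ih _ (by rw [Finset.card_erase_of_mem hj, hT]; rfl)

theorem aux_decomp {ι : Type*} [Finite ι] (x : ι → ℝ) :
    ∃ (r : ℕ) (t : Fin r → ℝ) (C : ι → Fin r → ℚ), LinearIndependent ℚ t ∧
      ∀ i, x i = ∑ k, (C i k : ℝ) * t k := by
  let V := Submodule.span ℚ (Set.range x)
  have : FiniteDimensional ℚ V := FiniteDimensional.span_of_finite ℚ (Set.finite_range x)
  let b := Module.finBasis ℚ V
  refine ⟨_, fun k => (b k : ℝ), fun i => b.repr ⟨x i, Submodule.subset_span ⟨i, rfl⟩⟩, ?_, ?_⟩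
  · exact b.linearIndependent.map' V.subtype (Submodule.ker_subtype _)
  · intro i
    have := congrArg V.subtype (b.sum_repr ⟨x i, Submodule.subset_span ⟨i, rfl⟩⟩)
    rw [map_sum] at this
    simp only [map_smul, Submodule.subtype_apply, Rat.smul_def] at this
    exact this.symm

theorem aux_indep {r : ℕ} {t : Fin r → ℝ} (ht : LinearIndependent ℚ t) (c : Fin r → ℚ)
    (h : ∑ k, (c k : ℝ) * t k = 0) (k : Fin r) : c k = 0 := by
  rw [Fintype.linearIndependent_iff] at ht
  exact ht c (by simpa [Rat.smul_def] using h) k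

theorem aux_decomp_finset {ι : Type*} [DecidableEq ι] (s : Finset ι) (x : ι → ℝ) :
    ∃ (r : ℕ) (t : Fin r → ℝ) (C : ι → Fin r → ℚ), LinearIndependent ℚ t ∧
      ∀ i ∈ s, x i = ∑ k, (C i k : ℝ) * t k := by
  obtain ⟨r, t, C, ht, h⟩ := aux_decomp (fun i : s => x i)
  refine ⟨r, t, fun i => if h : i ∈ s then C ⟨i, h⟩ else 0, ht, fun i hi => ?_⟩
  simp only [hi, dif_pos]
  exact h ⟨i, hi⟩

open Filter Topology in
theorem aux_perturb_one {r d : ℕ} {t : Fin r → ℝ} (ht : LinearIndependent ℚ t)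
    (S : Finset (Fin d → ℚ)) (c : (Fin d → ℚ) → ℝ) (C : (Fin d → ℚ) → Fin r → ℚ)
    (hc : ∀ g, 0 ≤ c g) (hC : ∀ g ∈ S, c g = ∑ k, (C g k : ℝ) * t k) (k : Fin r) :
    ∀ᶠ ε : ℝ in 𝓝 0, ∃ c' : (Fin d → ℚ) → ℝ, (∀ g, 0 ≤ c' g) ∧
      (∑ g ∈ S, c g • (fun i => (g i : ℝ))) +
        ε • (fun i => ((∑ g ∈ S, C g k * g i : ℚ) : ℝ)) =
        ∑ g ∈ S, c' g • (fun i => (g i : ℝ)) := by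
  have h1 : ∀ᶠ ε : ℝ in 𝓝 0, ∀ g ∈ S, 0 ≤ c g + ε * C g k := by
    rw [Filter.eventually_all_finset]
    intro g hg
    rcases (hc g).eq_or_lt with h | h
    · have : C g k = 0 := aux_indep ht (C g) (by rw [← hC g hg, ← h]) k
      filter_upwards with ε
      rw [this, ← h]; simp
    · have hcont : Continuous fun ε : ℝ => c g + ε * C g k := by fun_prop
      have := hcont.continuousAt (x := 0)
      have h2 := this.eventually (lt_mem_nhds (a := 0) (by simpa using h))
      filter_upwards [h2] with ε hε using hε.le
  filter_upwards [h1] with ε hε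
  refine ⟨fun g => max 0 (c g + ε * C g k), fun g => le_max_left _ _, ?_⟩
  have : ∑ g ∈ S, max 0 (c g + ε * C g k) • (fun i => (g i : ℝ)) =
      ∑ g ∈ S, (c g + ε * C g k) • (fun i => (g i : ℝ)) :=
    Finset.sum_congr rfl fun g hg => by rw [max_eq_right (hε g hg)]
  rw [this]
  funext i
  simp only [Pi.add_apply, Finset.sum_apply, Pi.smul_apply, smul_eq_mul, Rat.cast_sum,
    Rat.cast_mul, add_mul, Finset.sum_add_distrib, Finset.mul_sum, mul_assoc]

open Filter Topology in
theorem aux_perturb {d : ℕ} {σ τ : Set (Fin d → ℝ)} (hσ : IsRationalPolyhedralCone σ)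
    (hτ : IsRationalPolyhedralCone τ) (v : Fin d → ℝ) (hvσ : v ∈ σ) (hvτ : v ∈ τ) :
    ∃ (r : ℕ) (t : Fin r → ℝ) (w : Fin r → Fin d → ℚ), LinearIndependent ℚ t ∧
      (∀ j, v j = ∑ k, (w k j : ℝ) * t k) ∧
      ∀ k, ∀ᶠ ε : ℝ in 𝓝 0, v + ε • (fun i => (w k i : ℝ)) ∈ σ ∧
        v + ε • (fun i => (w k i : ℝ)) ∈ τ := by
  classical
  obtain ⟨S, rfl⟩ := hσ
  obtain ⟨T, rfl⟩ := hτ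
  obtain ⟨c, hc, hv⟩ := hvσ
  obtain ⟨c', hc', hv'⟩ := hvτ
  obtain ⟨r, t, C, ht, hC⟩ := aux_decomp_finset (S.disjSum T) (Sum.elim c c')
  have hCS : ∀ g ∈ S, c g = ∑ k, (C (Sum.inl g) k : ℝ) * t k := fun g hg =>
    hC (Sum.inl g) (by simpa using hg)
  have hCT : ∀ g ∈ T, c' g = ∑ k, (C (Sum.inr g) k : ℝ) * t k := fun g hg =>
    hC (Sum.inr g) (by simpa using hg)
  have key : ∀ (S : Finset (Fin d → ℚ)) (c : (Fin d → ℚ) → ℝ) (C : (Fin d → ℚ) → Fin r → ℚ),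
      (∀ g ∈ S, c g = ∑ k, (C g k : ℝ) * t k) → v = ∑ g ∈ S, c g • (fun i => (g i : ℝ)) →
      ∀ j, v j = ∑ k, ((∑ g ∈ S, C g k * g j : ℚ) : ℝ) * t k := by
    intro S c C hC hv j
    rw [hv]
    simp only [Finset.sum_apply, Pi.smul_apply, smul_eq_mul, Rat.cast_sum, Rat.cast_mul,
      Finset.sum_mul]
    rw [Finset.sum_comm]
    refine Finset.sum_congr rfl fun g hg => ?_
    rw [hC g hg, Finset.sum_mul]
    exact Finset.sum_congr rfl fun k _ => by ring
  have k1 := key S c (fun g => C (Sum.inl g)) hCS hv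
  have k2 := key T c' (fun g => C (Sum.inr g)) hCT hv'
  have heq : ∀ k j, ∑ g ∈ S, C (Sum.inl g) k * g j = ∑ g ∈ T, C (Sum.inr g) k * g j := by
    intro k j
    have := aux_indep ht
      (fun k => ∑ g ∈ S, C (Sum.inl g) k * g j - ∑ g ∈ T, C (Sum.inr g) k * g j)
      (by
        simp only [Rat.cast_sub, sub_mul, Finset.sum_sub_distrib]
        rw [← k1 j, ← k2 j, sub_self]) k
    exact sub_eq_zero.1 this
  refine ⟨r, t, fun k j => ∑ g ∈ S, C (Sum.inl g) k * g j, ht, k1, fun k => ?_⟩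
  have e1 := aux_perturb_one ht S c (fun g => C (Sum.inl g)) hc hCS k
  have e2 := aux_perturb_one ht T c' (fun g => C (Sum.inr g)) hc' hCT k
  filter_upwards [e1, e2] with ε h1 h2
  constructor
  · obtain ⟨a, ha, h⟩ := h1
    exact ⟨a, ha, by rw [← h, ← hv]⟩
  · obtain ⟨a, ha, h⟩ := h2
    refine ⟨a, ha, ?_⟩
    rw [← h, ← hv']
    simp only [heq]

theorem aux_closed {d : ℕ} {σ : Set (Fin d → ℝ)} (hσ : IsRationalPolyhedralCone σ) :
    IsClosed σ := by
  classical
  obtain ⟨S, rfl⟩ := hσ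
  convert aux_cone_closed (fun (g : Fin d → ℚ) i => (g i : ℝ)) _ S rfl using 1
  ext v
  constructor
  · rintro ⟨c, hc, h⟩
    exact ⟨c, fun g _ => hc g, h⟩
  · rintro ⟨c, hc, h⟩
    refine ⟨fun g => max 0 (c g), fun g => le_max_left _ _, ?_⟩
    rw [h]
    exact Finset.sum_congr rfl fun g hg => by simp only [max_eq_right (hc g hg)]

theorem aux_smul_mem {d : ℕ} {σ : Set (Fin d → ℝ)} (hσ : IsRationalPolyhedralCone σ)
    {v : Fin d → ℝ} (hv : v ∈ σ) {s : ℝ} (hs : 0 ≤ s) : s • v ∈ σ := by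
  obtain ⟨S, rfl⟩ := hσ
  obtain ⟨c, hc, rfl⟩ := hv
  refine ⟨fun g => s * c g, fun g => mul_nonneg hs (hc g), ?_⟩
  simp only [Finset.smul_sum, mul_smul]

theorem aux_add_mem {d : ℕ} {σ : Set (Fin d → ℝ)} (hσ : IsRationalPolyhedralCone σ)
    {v w : Fin d → ℝ} (hv : v ∈ σ) (hw : w ∈ σ) : v + w ∈ σ := by
  obtain ⟨S, rfl⟩ := hσ
  obtain ⟨c, hc, rfl⟩ := hv
  obtain ⟨c', hc', rfl⟩ := hw
  refine ⟨fun g => c g + c' g, fun g => add_nonneg (hc g) (hc' g), ?_⟩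
  simp only [add_smul, Finset.sum_add_distrib]

/-- If `a ε + b ε² ≤ 0` near `0`, then `a = 0`. -/
theorem aux_first_order (a b : ℝ) (h : ∀ᶠ ε : ℝ in nhds 0, a * ε + b * ε ^ 2 ≤ 0) : a = 0 := by
  have hd : HasDerivAt (fun ε : ℝ => a * ε + b * ε ^ 2) a 0 := by
    have h1 := ((hasDerivAt_id (0 : ℝ)).const_mul a).add
      (((hasDerivAt_id (0 : ℝ)).pow 2).const_mul b)
    have h2 : HasDerivAt ((fun y : ℝ => a * y) + fun y : ℝ => b * y ^ 2) a 0 := by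
      simpa using h1
    exact h2
  refine IsLocalMax.hasDerivAt_eq_zero ?_ hd
  filter_upwards [h] with ε hε
  simpa using hε

theorem aux_rational {d r : ℕ} (F : (Fin d → ℝ) →ₗ[ℝ] ℝ)
    (P : (Fin d → ℝ) →ₗ[ℝ] (Fin d → ℝ) →ₗ[ℝ] ℝ)
    (hF : ∀ x : Fin d → ℚ, ∃ z : ℚ, F (fun i => (x i : ℝ)) = z)
    (hP : ∀ x y : Fin d → ℚ, ∃ z : ℚ, P (fun i => (x i : ℝ)) (fun i => (y i : ℝ)) = z)
    (hpos : ∀ x, x ≠ 0 → 0 < P x x)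
    {t : Fin r → ℝ} (ht : LinearIndependent ℚ t) (w : Fin r → Fin d → ℚ) (v : Fin d → ℝ)
    (hv : v = ∑ k, t k • (fun i => (w k i : ℝ))) (hFv : F v ≠ 0)
    (hcrit : ∀ k, F (fun i => (w k i : ℝ)) * P v v = F v * P v (fun i => (w k i : ℝ))) :
    ∃ (x : Fin d → ℚ) (c : ℝ), 0 < c ∧ v = c • (fun i => (x i : ℝ)) := by
  set W : Fin r → Fin d → ℝ := fun k i => (w k i : ℝ) with hW
  have hv' : v = ∑ k, t k • W k := hv
  have hcrit' : ∀ k, F (W k) * P v v = F v * P v (W k) := hcrit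
  have hk0 : ∃ k, F (W k) ≠ 0 := by
    by_contra hcon
    push Not at hcon
    apply hFv
    rw [hv', map_sum]
    exact Finset.sum_eq_zero fun k _ => by rw [map_smul, hcon k, smul_zero]
  obtain ⟨k0, hk0⟩ := hk0
  have h1 : ∀ k, F (W k0) * P v (W k) = F (W k) * P v (W k0) := by
    intro k
    apply mul_left_cancel₀ hFv
    have e1 := hcrit' k
    have e2 := hcrit' k0
    calc F v * (F (W k0) * P v (W k)) = F (W k0) * (F v * P v (W k)) := by ring
      _ = F (W k) * (F (W k0) * P v v) := by rw [← e1]; ring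
      _ = F v * (F (W k) * P v (W k0)) := by rw [e2]; ring
  have hPv : ∀ y, P v y = ∑ l, t l * P (W l) y := by
    intro y
    conv_lhs => rw [hv']
    rw [map_sum, LinearMap.sum_apply]
    exact Finset.sum_congr rfl fun l _ => by rw [map_smul, LinearMap.smul_apply, smul_eq_mul]
  choose fF hfF using fun k => hF (w k)
  choose fP hfP using fun l k => hP (w l) (w k)
  have hfF' : ∀ k, F (W k) = fF k := hfF
  have hfP' : ∀ l k, P (W l) (W k) = fP l k := hfP
  have h2 : ∀ k l, F (W k0) * P (W l) (W k) = F (W k) * P (W l) (W k0) := by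
    intro k l
    have := aux_indep ht (fun l => fF k0 * fP l k - fF k * fP l k0) (by
      have := h1 k
      rw [hPv, hPv, Finset.mul_sum, Finset.mul_sum, ← sub_eq_zero,
        ← Finset.sum_sub_distrib] at this
      rw [← this]
      refine Finset.sum_congr rfl fun l _ => ?_
      rw [hfF', hfF', hfP', hfP']
      push_cast
      ring) l
    rw [hfF', hfF', hfP', hfP']
    have h3 := sub_eq_zero.1 this
    exact_mod_cast h3
  have hW0 : W k0 ≠ 0 := by
    intro h
    exact hk0 (by rw [h, map_zero])
  have hP0 := hpos _ hW0
  have hu : P (W k0) (W k0) • v - P v (W k0) • W k0 = 0 := by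
    set u := P (W k0) (W k0) • v - P v (W k0) • W k0 with hu
    have hPu : ∀ k, P u (W k) = 0 := by
      intro k
      apply mul_left_cancel₀ hk0
      rw [hu]
      simp only [map_sub, map_smul, LinearMap.sub_apply, LinearMap.smul_apply, smul_eq_mul]
      linear_combination P (W k0) (W k0) * h1 k - P v (W k0) * h2 k k0
    by_contra hne
    have := hpos u hne
    have hPuv : P u v = 0 := by
      rw [hv', map_sum]
      exact Finset.sum_eq_zero fun k _ => by rw [map_smul, hPu k, smul_zero]
    have h0 : P u u = 0 := by
      conv_lhs => rw [hu, map_sub, map_smul, map_smul]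
      rw [← hu, hPuv, hPu]; simp
    linarith
  have hvc : v = (P v (W k0) / P (W k0) (W k0)) • W k0 := by
    have h3 := sub_eq_zero.1 hu
    rw [div_eq_inv_mul, mul_smul, ← h3, smul_smul, inv_mul_cancel₀ hP0.ne', one_smul]
  set c := P v (W k0) / P (W k0) (W k0)
  have hc : c ≠ 0 := by
    intro h
    apply hFv
    rw [hvc, h, zero_smul, map_zero]
  rcases lt_or_gt_of_ne hc with h | h
  · refine ⟨fun i => - w k0 i, -c, by linarith, ?_⟩
    rw [hvc]
    funext i
    simp [hW]
  · exact ⟨w k0, c, h, hvc⟩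

/-- Existence of a lexicographic minimizer. -/
theorem aux_exists {d : ℕ} (F m s : (Fin d → ℝ) → ℝ) (σ : Set (Fin d → ℝ))
    (hσcl : IsClosed σ) (hσs : ∀ v ∈ σ, ∀ c : ℝ, 0 ≤ c → c • v ∈ σ)
    (hFc : Continuous F) (hmc : Continuous m) (hsc : Continuous s)
    (hFh : ∀ c : ℝ, 0 < c → ∀ v, F (c • v) = c * F v)
    (hmh : ∀ c : ℝ, 0 < c → ∀ v, m (c • v) = c * m v)
    (hsh : ∀ c : ℝ, 0 < c → ∀ v, s (c • v) = c * s v)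
    (hm : ∀ v, v ≠ 0 → 0 < m v) (hs : ∀ v, v ≠ 0 → 0 < s v)
    (hne : ∃ v ∈ σ, v ≠ 0) :
    ∃ v ∈ σ, v ≠ 0 ∧ (∀ u ∈ σ, u ≠ 0 → F v / m v ≤ F u / m u) ∧
      (∀ u ∈ σ, u ≠ 0 → F u / m u = F v / m v → F v / s v ≤ F u / s u) := by
  have hK : IsCompact (σ ∩ Metric.sphere 0 1) := (isCompact_sphere _ _).inter_left hσcl
  have hK0 : ∀ u ∈ σ ∩ Metric.sphere 0 1, u ≠ 0 := by
    rintro u ⟨-, hu⟩ rfl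
    simp at hu
  have hnorm : ∀ u ∈ σ, u ≠ 0 → ‖u‖⁻¹ • u ∈ σ ∩ Metric.sphere 0 1 := by
    intro u hu hu0
    refine ⟨hσs u hu _ (by positivity), ?_⟩
    have : ‖u‖ ≠ 0 := norm_ne_zero_iff.2 hu0
    simp [norm_smul, this]
  have hinv : ∀ g : (Fin d → ℝ) → ℝ, (∀ c : ℝ, 0 < c → ∀ v, g (c • v) = c * g v) →
      ∀ u, u ≠ 0 → F (‖u‖⁻¹ • u) / g (‖u‖⁻¹ • u) = F u / g u := by
    intro g hg u hu
    have : 0 < ‖u‖⁻¹ := inv_pos.2 (norm_pos_iff.2 hu)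
    rw [hFh _ this, hg _ this, mul_div_mul_left _ _ this.ne']
  obtain ⟨u0, hu0, hu0'⟩ := hne
  obtain ⟨v1, hv1, hmin1⟩ := hK.exists_isMinOn ⟨_, hnorm u0 hu0 hu0'⟩
    (f := fun u => F u / m u)
    (hFc.continuousOn.div hmc.continuousOn fun u hu => (hm u (hK0 u hu)).ne')
  have hK1 : IsCompact ((σ ∩ Metric.sphere 0 1) ∩ {u | F u * m v1 = F v1 * m u}) :=
    hK.inter_right (isClosed_eq (by fun_prop) (by fun_prop))
  obtain ⟨v, hv, hmin⟩ := hK1.exists_isMinOn ⟨v1, hv1, rfl⟩ (f := fun u => F u / s u)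
    (hFc.continuousOn.div hsc.continuousOn fun u hu => (hs u (hK0 u hu.1)).ne')
  have hv0 := hK0 v hv.1
  have hm1 := hm v1 (hK0 v1 hv1)
  have heq : F v / m v = F v1 / m v1 := by
    rw [div_eq_div_iff (hm v hv0).ne' hm1.ne']
    exact hv.2
  refine ⟨v, hv.1.1, hv0, ?_, ?_⟩
  · intro u hu hu0
    rw [heq, ← hinv m hmh u hu0]
    exact hmin1 (hnorm u hu hu0)
  · intro u hu hu0 he
    rw [← hinv s hsh u hu0]
    refine hmin ⟨hnorm u hu hu0, ?_⟩
    have hn := hK0 _ (hnorm u hu hu0)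
    have : F (‖u‖⁻¹ • u) / m (‖u‖⁻¹ • u) = F v1 / m v1 := by
      rw [hinv m hmh u hu0, he, heq]
    rwa [div_eq_div_iff (hm _ hn).ne' hm1.ne'] at this

theorem aux_bilin {d : ℕ} (A : Fin d → Fin d → ℚ) :
    ∃ P : (Fin d → ℝ) →ₗ[ℝ] (Fin d → ℝ) →ₗ[ℝ] ℝ, (∀ x y, P x y = P y x) ∧
      (∀ x, P x x = ∑ i, ∑ j, (A i j : ℝ) * x i * x j) ∧
      ∀ x y : Fin d → ℚ, ∃ z : ℚ, P (fun i => (x i : ℝ)) (fun i => (y i : ℝ)) = z := by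
  refine ⟨LinearMap.mk₂ ℝ
    (fun x y => ∑ i, ∑ j, (A i j : ℝ) * ((x i * y j + y i * x j) / 2)) ?_ ?_ ?_ ?_, ?_, ?_, ?_⟩
  · intro x x' y
    simp only [← Finset.sum_add_distrib, Pi.add_apply]
    refine Finset.sum_congr rfl fun i _ => Finset.sum_congr rfl fun j _ => by ring
  · intro c x y
    simp only [smul_eq_mul, Finset.mul_sum, Pi.smul_apply]
    refine Finset.sum_congr rfl fun i _ => Finset.sum_congr rfl fun j _ => by ring
  · intro x x' y
    simp only [← Finset.sum_add_distrib, Pi.add_apply]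
    refine Finset.sum_congr rfl fun i _ => Finset.sum_congr rfl fun j _ => by ring
  · intro c x y
    simp only [smul_eq_mul, Finset.mul_sum, Pi.smul_apply]
    refine Finset.sum_congr rfl fun i _ => Finset.sum_congr rfl fun j _ => by ring
  · intro x y
    simp only [LinearMap.mk₂_apply]
    refine Finset.sum_congr rfl fun i _ => Finset.sum_congr rfl fun j _ => by ring
  · intro x
    simp only [LinearMap.mk₂_apply]
    refine Finset.sum_congr rfl fun i _ => Finset.sum_congr rfl fun j _ => by ring
  · intro x y
    refine ⟨∑ i, ∑ j, A i j * ((x i * y j + y i * x j) / 2), ?_⟩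
    simp only [LinearMap.mk₂_apply]
    push_cast
    rfl

theorem aux_lin {d : ℕ} {F : (Fin d → ℝ) → ℝ} (hF : IsRationalLinear F) :
    ∃ G : (Fin d → ℝ) →ₗ[ℝ] ℝ, (∀ v, F v = G v) ∧
      ∀ x : Fin d → ℚ, ∃ z : ℚ, G (fun i => (x i : ℝ)) = z := by
  obtain ⟨a, ha⟩ := hF
  refine ⟨⟨⟨F, ?_⟩, ?_⟩, fun v => rfl, ?_⟩
  · intro x y
    simp only [ha, ← Finset.sum_add_distrib, Pi.add_apply]
    exact Finset.sum_congr rfl fun i _ => by ring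
  · intro c x
    simp only [ha, smul_eq_mul, Finset.mul_sum, Pi.smul_apply, RingHom.id_apply]
    exact Finset.sum_congr rfl fun i _ => by ring
  · intro x
    refine ⟨∑ i, a i * x i, ?_⟩
    change F _ = _
    rw [ha]
    push_cast
    rfl

/-- Abstraction of Proposition 3.5: with `F` rational linear, `m` rational piecewise
linear convex and positive away from `0`, `q` a rational positive definite quadratic
form, and `σ` a rational polyhedral cone meeting `{F < 0}`, the infimum of the
lexicographically ordered bi-valued function `μ(v) = (F v / m v, F v / √q v)` over
`σ \ {0}` is achieved at a unique ray, and that ray contains a rational point. -/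
theorem stmt4 {d : ℕ} (F : (Fin d → ℝ) → ℝ) (hFlin : IsRationalLinear F)
    (m : (Fin d → ℝ) → ℝ) (hmpl : IsRationalPiecewiseLinear m)
    (hmconv : ConvexOn ℝ Set.univ m) (hmpos : ∀ v : Fin d → ℝ, v ≠ 0 → 0 < m v)
    (q : (Fin d → ℝ) → ℝ)
    (hqrat : ∃ A : Fin d → Fin d → ℚ, ∀ v, q v = ∑ i, ∑ j, (A i j : ℝ) * v i * v j)
    (hqpos : ∀ v : Fin d → ℝ, v ≠ 0 → 0 < q v)
    (σ : Set (Fin d → ℝ)) (hσ : IsRationalPolyhedralCone σ)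
    (hneg : ∃ v ∈ σ, F v < 0)
    (μ : (Fin d → ℝ) → Lex (ℝ × ℝ))
    (hμ : ∀ v, μ v = toLex (F v / m v, F v / Real.sqrt (q v))) :
    ∃ v₀ : Fin d → ℚ,
      (fun i => (v₀ i : ℝ)) ∈ σ ∧ (fun i => (v₀ i : ℝ)) ≠ 0 ∧
      (∀ v ∈ σ, v ≠ 0 → μ (fun i => (v₀ i : ℝ)) ≤ μ v) ∧
      (∀ v ∈ σ, v ≠ 0 → μ v = μ (fun i => (v₀ i : ℝ)) →
        ∃ c : ℝ, 0 < c ∧ v = c • (fun i => (v₀ i : ℝ))) := by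
  obtain ⟨G, hFG, hGrat⟩ := aux_lin hFlin
  obtain rfl : F = G := funext hFG
  obtain ⟨A, hA⟩ := hqrat
  obtain ⟨P, hPs, hPd, hPrat⟩ := aux_bilin A
  have hqP : ∀ v, q v = P v v := fun v => by rw [hA, hPd]
  have hPpos : ∀ x, x ≠ 0 → 0 < P x x := fun x hx => by rw [← hqP]; exact hqpos x hx
  have hGc : Continuous G := LinearMap.continuous_of_finiteDimensional G
  have hmc : Continuous m := by
    rw [← continuousOn_univ]
    exact hmconv.continuousOn isOpen_univ
  have hqc : Continuous q := by
    have : q = fun v => ∑ i, ∑ j, (A i j : ℝ) * v i * v j := funext hA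
    rw [this]; fun_prop
  obtain ⟨n, τ, L, hτ, hcov, hL⟩ := hmpl
  have hpiece : ∀ v, ∃ i, v ∈ τ i := fun v => by
    have : v ∈ ⋃ i, τ i := by rw [hcov]; trivial
    simpa using this
  have hmh : ∀ c : ℝ, 0 < c → ∀ v, m (c • v) = c * m v := by
    intro c hc v
    obtain ⟨i, hi⟩ := hpiece v
    obtain ⟨l, hl, -⟩ := aux_lin (hL i).1
    rw [(hL i).2 v hi, (hL i).2 _ (aux_smul_mem (hτ i) hi hc.le), hl, hl, map_smul, smul_eq_mul]
  have hGh : ∀ c : ℝ, 0 < c → ∀ v, G (c • v) = c * G v := fun c _ v => by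
    rw [map_smul, smul_eq_mul]
  have hqh : ∀ (c : ℝ) v, q (c • v) = c ^ 2 * q v := by
    intro c v
    rw [hqP, hqP, map_smul, map_smul, LinearMap.smul_apply, smul_eq_mul, smul_eq_mul]
    ring
  have hsh : ∀ c : ℝ, 0 < c → ∀ v, Real.sqrt (q (c • v)) = c * Real.sqrt (q v) := by
    intro c hc v
    rw [hqh, Real.sqrt_mul (sq_nonneg c), Real.sqrt_sq hc.le]
  have hspos : ∀ v, v ≠ 0 → 0 < Real.sqrt (q v) := fun v hv => Real.sqrt_pos.2 (hqpos v hv)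
  obtain ⟨u0, hu0, hu0neg⟩ := hneg
  have hGne : ∀ u, G u < 0 → u ≠ 0 := by
    rintro u hu rfl
    simp at hu
  obtain ⟨v, hvσ, hv0, hmin1, hmin2⟩ := aux_exists G m (fun v => Real.sqrt (q v)) σ
    (aux_closed hσ) (fun v hv c hc => aux_smul_mem hσ hv hc) hGc hmc
    (Real.continuous_sqrt.comp hqc) hGh hmh hsh hmpos hspos ⟨u0, hu0, hGne u0 hu0neg⟩
  have hmv := hmpos v hv0
  have hlam : G v / m v < 0 :=
    (hmin1 u0 hu0 (hGne u0 hu0neg)).trans_lt (div_neg_of_neg_of_pos hu0neg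
      (hmpos u0 (hGne u0 hu0neg)))
  have hGv : G v < 0 := by
    by_contra hcon
    exact absurd (div_nonneg (not_lt.1 hcon) hmv.le) (not_le.2 hlam)
  -- general inequalities
  have hge1 : ∀ u ∈ σ, u ≠ 0 → G v * m u ≤ G u * m v := by
    intro u hu hu0
    have := hmin1 u hu hu0
    rwa [div_le_div_iff₀ hmv (hmpos u hu0)] at this
  have hge2 : ∀ u ∈ σ, G u < 0 → G u * m v ≤ G v * m u → G u ^ 2 * q v ≤ G v ^ 2 * q u := by
    intro u hu hneg hle
    have hu0 := hGne u hneg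
    have he : G u / m u = G v / m v := by
      rw [div_eq_div_iff (hmpos u hu0).ne' hmv.ne']
      exact le_antisymm hle (hge1 u hu hu0)
    have h := hmin2 u hu hu0 he
    rw [div_le_div_iff₀ (hspos v hv0) (hspos u hu0)] at h
    have h' : (-G u) * Real.sqrt (q v) ≤ (-G v) * Real.sqrt (q u) := by linarith
    have h3 := mul_self_le_mul_self (mul_nonneg (by linarith) (Real.sqrt_nonneg _)) h'
    have s1 := Real.mul_self_sqrt (hqpos v hv0).le
    have s2 := Real.mul_self_sqrt (hqpos u hu0).le
    calc G u ^ 2 * q v = (-G u) * √(q v) * ((-G u) * √(q v)) := by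
          linear_combination (-G u ^ 2) * s1
      _ ≤ _ := h3
      _ = G v ^ 2 * q u := by linear_combination (G v ^ 2) * s2
  -- uniqueness
  have huniq : ∀ u ∈ σ, u ≠ 0 → G u / m u = G v / m v →
      G u / Real.sqrt (q u) = G v / Real.sqrt (q v) → ∃ c : ℝ, 0 < c ∧ u = c • v := by
    intro u hu hu0 he1 he2
    have hmu := hmpos u hu0
    have hGu : G u < 0 := by
      by_contra hcon
      exact absurd (div_nonneg (not_lt.1 hcon) hmu.le) (not_le.2 (he1 ▸ hlam))
    have hc : 0 < G u / G v := div_pos_of_neg_of_neg hGu hGv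
    refine ⟨G u / G v, hc, ?_⟩
    set c := G u / G v with hcdef
    have hGuc : G u = c * G v := by rw [hcdef, div_mul_cancel₀ _ hGv.ne]
    have hcvσ : c • v ∈ σ := aux_smul_mem hσ hvσ hc.le
    have hmuc : m u = c * m v := by
      rw [div_eq_div_iff hmu.ne' hmv.ne', hGuc] at he1
      apply mul_left_cancel₀ hGv.ne
      linear_combination -he1
    have hquc : q u = c ^ 2 * q v := by
      rw [div_eq_div_iff (hspos u hu0).ne' (hspos v hv0).ne', hGuc] at he2
      have : √(q u) = c * √(q v) := by
        apply mul_left_cancel₀ hGv.ne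
        linear_combination -he2
      rw [← Real.sq_sqrt (hqpos u hu0).le, this, mul_pow, Real.sq_sqrt (hqpos v hv0).le]
    by_contra hne
    have hd := hqpos _ (sub_ne_zero.2 hne)
    have hsum : u + c • v ∈ σ := aux_add_mem hσ hu hcvσ
    have hGsum : G (u + c • v) = 2 * c * G v := by
      rw [map_add, hGh c hc, hGuc]; ring
    have hmsum : m (u + c • v) ≤ 2 * c * m v := by
      have h := hmconv.2 (Set.mem_univ u) (Set.mem_univ (c • v))
        (show (0 : ℝ) ≤ 1 / 2 by norm_num) (show (0 : ℝ) ≤ 1 / 2 by norm_num) (by norm_num)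
      rw [← smul_add, hmh _ (by norm_num), hmh c hc, hmuc, smul_eq_mul] at h
      linarith
    have hpar : q (u + c • v) + q (u - c • v) = 2 * q u + 2 * q (c • v) := by
      simp only [hqP, map_add, map_sub, LinearMap.add_apply, LinearMap.sub_apply]
      ring
    have hneg' : G (u + c • v) < 0 := by rw [hGsum]; nlinarith
    have h := hge2 _ hsum hneg' (by rw [hGsum]; nlinarith)
    rw [hGsum] at h
    rw [hqh, hquc] at hpar
    have hG2 : 0 < G v ^ 2 := by have := mul_pos_of_neg_of_neg hGv hGv; rwa [← sq] at this
    have : G v ^ 2 * q (u + c • v) = G v ^ 2 * (4 * c ^ 2 * q v) - G v ^ 2 * q (u - c • v) := by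
      linear_combination G v ^ 2 * hpar
    nlinarith [mul_pos hG2 hd]
  -- rationality
  have hrat : ∃ (x : Fin d → ℚ) (c : ℝ), 0 < c ∧ v = c • (fun i => (x i : ℝ)) := by
    obtain ⟨i, hi⟩ := hpiece v
    obtain ⟨l, hl, -⟩ := aux_lin (hL i).1
    have hml : ∀ u ∈ τ i, m u = l u := fun u hu => by rw [(hL i).2 u hu, hl]
    obtain ⟨r, t, w, ht, hvt, hw⟩ := aux_perturb hσ (hτ i) v hvσ hi
    refine aux_rational G P hGrat hPrat hPpos ht w v ?_ hGv.ne ?_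
    · funext j
      rw [hvt j]
      simp only [Finset.sum_apply, Pi.smul_apply, smul_eq_mul]
      exact Finset.sum_congr rfl fun k _ => by ring
    · intro k
      set W : Fin d → ℝ := fun i => (w k i : ℝ) with hW
      have hev : ∀ᶠ ε : ℝ in nhds 0, v + ε • W ∈ σ ∧ v + ε • W ∈ τ i := hw k
      have hevneg : ∀ᶠ ε : ℝ in nhds 0, G (v + ε • W) < 0 := by
        have hcont : Continuous fun ε : ℝ => G (v + ε • W) := by fun_prop
        exact hcont.continuousAt.eventually (gt_mem_nhds (by simpa using hGv))
      have hmlv := hml v hi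
      have hlin : G v * l W - G W * l v = 0 := by
        refine aux_first_order _ 0 ?_
        filter_upwards [hev, hevneg] with ε h1 h2
        have h := hge1 _ h1.1 (hGne _ h2)
        rw [hml _ h1.2, hmlv] at h
        simp only [map_add, map_smul, smul_eq_mul] at h
        linarith
      have hq0 : 2 * (G v * G W * P v v - G v ^ 2 * P v W) = 0 := by
        refine aux_first_order _ (G W ^ 2 * P v v - G v ^ 2 * P W W) ?_
        filter_upwards [hev, hevneg] with ε h1 h2
        have h := hge2 _ h1.1 h2 (by
          rw [hml _ h1.2, hmlv]
          simp only [map_add, map_smul, smul_eq_mul]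
          apply le_of_eq
          linear_combination (-ε) * hlin)
        rw [hqP, hqP] at h
        simp only [map_add, map_smul, smul_eq_mul, LinearMap.add_apply, LinearMap.smul_apply] at h
        rw [hPs W v] at h
        linarith
      apply mul_left_cancel₀ hGv.ne
      linear_combination hq0 / 2
  obtain ⟨x, c, hc, hvx⟩ := hrat
  set X : Fin d → ℝ := fun i => (x i : ℝ) with hX
  have hXv : X = c⁻¹ • v := by
    rw [hvx, smul_smul, inv_mul_cancel₀ hc.ne', one_smul]
  have hci : 0 < c⁻¹ := inv_pos.2 hc
  have hμX : μ X = μ v := by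
    rw [hμ, hμ, hXv, hGh _ hci, hmh _ hci, hsh _ hci, mul_div_mul_left _ _ hci.ne',
      mul_div_mul_left _ _ hci.ne']
  refine ⟨x, ?_, ?_, ?_, ?_⟩
  · change X ∈ σ
    rw [hXv]; exact aux_smul_mem hσ hvσ hci.le
  · change X ≠ 0
    rw [hXv]; exact smul_ne_zero hci.ne' hv0
  · intro u hu hu0
    change μ X ≤ μ u
    rw [hμX, hμ, hμ, Prod.Lex.toLex_le_toLex]
    rcases (hmin1 u hu hu0).lt_or_eq with h | h
    · exact Or.inl h
    · exact Or.inr ⟨h, hmin2 u hu hu0 h.symm⟩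
  · intro u hu hu0 he
    change μ u = μ X at he
    change ∃ c : ℝ, 0 < c ∧ u = c • X
    rw [hμX, hμ, hμ] at he
    have he' := toLex.injective he
    rw [Prod.mk.injEq] at he'
    obtain ⟨c', hc', h⟩ := huniq u hu hu0 he'.1 he'.2
    refine ⟨c' * c, mul_pos hc' hc, ?_⟩
    rw [h, mul_smul, ← hvx]
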